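/- Let A be a bounded self-adjoint operator on ℓ²(ℤ, ℂ) that is banded with bandwidth b (⟨e_i, A e_k⟩ = 0 whenever |i−k| > b) and satisfies ‖A − I‖ ≤ r for some r < 1. Let Q be the unique positive square root of A. Then there is a constant K such that the matrix entries q_{lk} = ⟨e_l, Q e_k⟩ satisfy |q_{lk}| ≤ K r^{|l−k|/b} for all l, k ∈ ℤ. Moreover, A and Q are invertible and the matrix entries of Q^{-1} satisfy a bound of the same form |⟨e_l, Q^{-1} e_k⟩| ≤ K' r^{|l−k|/b} for some constant K'. -/

import Mathlib

open scoped ComplexInnerProductSpace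

noncomputable abbrev l2Z : Type := lp (fun _ : ℤ => ℂ) 2

/-- the standard basis vector of `ℓ²(ℤ, ℂ)` -/
noncomputable def e (i : ℤ) : l2Z := lp.single 2 i 1

namespace Ring

theorem choose_succ_mul (a : ℝ) (n : ℕ) :
    choose a (n + 1) * (n + 1) = choose a n * (a - n) := by
  simpa [nsmul_eq_mul, mul_comm] using choose_smul_choose a (Nat.le_succ n)

theorem abs_choose_le_one {a : ℝ} (ha : |a| ≤ 1) (n : ℕ) : |choose a n| ≤ 1 := by
  induction n with
  | zero => simp
  | succ n ih =>
    have hn : (0 : ℝ) < n + 1 := by positivity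
    have h := congrArg abs (choose_succ_mul a n)
    rw [abs_mul, abs_mul, abs_of_pos hn] at h
    have h' : |a - n| ≤ n + 1 := by
      rw [abs_le] at ha ⊢
      constructor <;> linarith
    refine le_of_mul_le_mul_right ?_ hn
    rw [h]
    exact mul_le_mul ih h' (abs_nonneg _) zero_le_one

end Ring

section BinomialSum

variable {𝔸 : Type*} [NormedRing 𝔸] [NormedAlgebra ℝ 𝔸]

/-- The sum `(1 + x) ^ a` of the binomial series. -/
noncomputable def binomialSum (a : ℝ) (x : 𝔸) : 𝔸 := ∑' n : ℕ, Ring.choose a n • x ^ n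

theorem norm_choose_smul_pow_le [NormOneClass 𝔸] {a : ℝ} (ha : |a| ≤ 1) (x : 𝔸) (n : ℕ) :
    ‖Ring.choose a n • x ^ n‖ ≤ ‖x‖ ^ n := by
  rw [norm_smul, Real.norm_eq_abs]
  exact (mul_le_of_le_one_left (norm_nonneg _) (Ring.abs_choose_le_one ha n)).trans
    (norm_pow_le x n)

theorem summable_norm_choose_smul_pow [NormOneClass 𝔸] {a : ℝ} (ha : |a| ≤ 1) {x : 𝔸}
    (hx : ‖x‖ < 1) :
    Summable fun n : ℕ => ‖Ring.choose a n • x ^ n‖ :=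
  .of_nonneg_of_le (fun _ => norm_nonneg _) (norm_choose_smul_pow_le ha x)
    (summable_geometric_of_lt_one (norm_nonneg x) hx)

theorem binomialSum_mul [NormOneClass 𝔸] [CompleteSpace 𝔸] {a b : ℝ} (ha : |a| ≤ 1)
    (hb : |b| ≤ 1) {x : 𝔸} (hx : ‖x‖ < 1) :
    binomialSum a x * binomialSum b x = binomialSum (a + b) x := by
  rw [binomialSum, binomialSum, tsum_mul_tsum_eq_tsum_sum_antidiagonal_of_summable_norm
    (summable_norm_choose_smul_pow ha hx) (summable_norm_choose_smul_pow hb hx), binomialSum]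
  refine tsum_congr fun n => ?_
  rw [Ring.add_choose_eq n (Commute.all a b), Finset.sum_smul]
  refine Finset.sum_congr rfl fun p hp => ?_
  rw [smul_mul_smul_comm, ← pow_add, Finset.HasAntidiagonal.mem_antidiagonal.mp hp]

theorem binomialSum_zero (x : 𝔸) : binomialSum 0 x = 1 := by
  rw [binomialSum, tsum_eq_single 0 fun n hn => ?_]
  · simp
  · rw [Ring.choose_zero_pos ℝ (Nat.pos_of_ne_zero hn), zero_smul]

theorem binomialSum_one (x : 𝔸) : binomialSum 1 x = 1 + x := by
  rw [binomialSum, tsum_eq_sum (s := Finset.range 2) fun n hn => ?_]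
  · simp [Finset.sum_range_succ]
  · have h := Ring.choose_natCast (R := ℝ) 1 n
    rw [Nat.cast_one] at h
    rw [h, Nat.choose_eq_zero_of_lt (by simpa using hn), Nat.cast_zero, zero_smul]

theorem IsSelfAdjoint.binomialSum [StarRing 𝔸] [ContinuousStar 𝔸] [StarModule ℝ 𝔸]
    (a : ℝ) {x : 𝔸} (hx : IsSelfAdjoint x) : IsSelfAdjoint (binomialSum a x) := by
  rw [isSelfAdjoint_iff, _root_.binomialSum, tsum_star]
  simp [hx.star_eq]

theorem binomialSum_mul_neg [NormOneClass 𝔸] [CompleteSpace 𝔸] {a : ℝ} (ha : |a| ≤ 1)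
    {x : 𝔸} (hx : ‖x‖ < 1) :
    binomialSum a x * binomialSum (-a) x = 1 := by
  rw [binomialSum_mul ha (by rwa [abs_neg]) hx, add_neg_cancel, binomialSum_zero]

theorem binomialSum_neg_mul [NormOneClass 𝔸] [CompleteSpace 𝔸] {a : ℝ} (ha : |a| ≤ 1)
    {x : 𝔸} (hx : ‖x‖ < 1) :
    binomialSum (-a) x * binomialSum a x = 1 := by
  rw [binomialSum_mul (by rwa [abs_neg]) ha hx, neg_add_cancel, binomialSum_zero]

end BinomialSum

section Hilbert

variable {H : Type*} [NormedAddCommGroup H] [InnerProductSpace ℂ H] [CompleteSpace H]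
  [Nontrivial H]

theorem eq_binomialSum_half_of_mul_self_eq {A Q : H →L[ℂ] H} (hA : IsSelfAdjoint A)
    (hA1 : ‖A - 1‖ < 1) (hQ0 : 0 ≤ Q) (hQ : Q * Q = A) : Q = binomialSum (1 / 2) (A - 1) := by
  have hXsa : IsSelfAdjoint (A - 1) := hA.sub (.one _)
  have h4 : |(1 / 4 : ℝ)| ≤ 1 := by norm_num [abs_le]
  have h2 : |(1 / 2 : ℝ)| ≤ 1 := by norm_num [abs_le]
  have hroot : binomialSum (1 / 2) (A - 1) * binomialSum (1 / 2) (A - 1) = A := by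
    rw [binomialSum_mul h2 h2 hA1, add_halves, binomialSum_one, add_sub_cancel]
  have hpos : 0 ≤ binomialSum (1 / 2) (A - 1) := by
    have h : binomialSum (1 / 2) (A - 1) =
        star (binomialSum (1 / 4) (A - 1)) * binomialSum (1 / 4) (A - 1) := by
      rw [(hXsa.binomialSum _).star_eq, binomialSum_mul h4 h4 hA1]
      norm_num
    rw [h]
    exact star_mul_self_nonneg _
  have hA0 : 0 ≤ A := by
    rw [← hQ]
    exact (IsSelfAdjoint.of_nonneg hQ0).mul_self_nonneg
  exact ((CFC.sqrt_eq_iff A Q hA0 hQ0).mpr hQ).symm.trans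
    ((CFC.sqrt_eq_iff A _ hA0 hpos).mpr hroot)

theorem hasSum_inner_binomialSum {a : ℝ} (ha : |a| ≤ 1) {X : H →L[ℂ] H} (hX : ‖X‖ < 1)
    (x y : H) :
    HasSum (fun n : ℕ => Ring.choose a n • ⟪x, (X ^ n) y⟫) ⟪x, binomialSum a X y⟫ := by
  have h := ((innerSL ℂ x).comp (ContinuousLinearMap.apply ℂ H y)).hasSum
    (summable_norm_choose_smul_pow ha hX).of_norm.hasSum
  simp_rw [← inner_smul_right_eq_smul]
  exact h

end Hilbert

theorem norm_e (i : ℤ) : ‖e i‖ = 1 := by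
  simp [e, lp.norm_single]

instance : Nontrivial l2Z := ⟨e 0, 0, fun h => by simpa [h] using norm_e 0⟩

theorem inner_e_left (i : ℤ) (v : l2Z) : ⟪e i, v⟫ = v i := by
  simp [e, lp.inner_single_left]

/-- `IsBanded w B` says that the matrix entries of `B` at distance more than `w` from the
diagonal vanish. -/
def IsBanded (w : ℤ) (B : l2Z →L[ℂ] l2Z) : Prop :=
  ∀ i k : ℤ, w < |i - k| → ⟪e i, B (e k)⟫ = 0

theorem isBanded_one : IsBanded 0 1 := by
  intro i k hik
  have h : i ≠ k := by rintro rfl; simp at hik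
  rw [inner_e_left, one_apply_eq_self, e, lp.single_apply_ne _ _ _ h]

theorem IsBanded.sub {w : ℤ} {B C : l2Z →L[ℂ] l2Z} (hB : IsBanded w B) (hC : IsBanded w C) :
    IsBanded w (B - C) := by
  intro i k hik
  rw [sub_apply, inner_sub_right, hB i k hik, hC i k hik, sub_zero]

theorem IsBanded.mono {v w : ℤ} {B : l2Z →L[ℂ] l2Z} (hB : IsBanded v B) (h : v ≤ w) :
    IsBanded w B := fun i k hik => hB i k (h.trans_lt hik)

theorem IsBanded.mul {v w : ℤ} {B C : l2Z →L[ℂ] l2Z} (hB : IsBanded v B) (hC : IsBanded w C) :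
    IsBanded (v + w) (B * C) := by
  intro i k hik
  rw [mul_apply_eq_comp, ← ContinuousLinearMap.adjoint_inner_left, lp.inner_eq_tsum]
  refine (tsum_congr fun j => ?_).trans tsum_zero
  by_cases hj : w < |j - k|
  · rw [← inner_e_left j (C (e k)), hC j k hj, inner_zero_right]
  · have hij : v < |i - j| := by
      have := abs_sub_le i j k
      lia
    have h : (ContinuousLinearMap.adjoint B (e i)) j = 0 := by
      rw [← inner_e_left, ContinuousLinearMap.adjoint_inner_right, ← inner_conj_symm,
        hB i j hij, map_zero]
    rw [h, inner_zero_left]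

theorem IsBanded.pow {w : ℤ} {B : l2Z →L[ℂ] l2Z} (hB : IsBanded w B) (n : ℕ) :
    IsBanded (n * w) (B ^ n) := by
  induction n with
  | zero => simpa using isBanded_one
  | succ n ih =>
    rw [pow_succ, Nat.cast_succ, add_one_mul]
    exact ih.mul hB

theorem IsBanded.norm_binomialSum_entry_le {b : ℕ} (hb : 0 < b) {r : ℝ} (hr : r < 1)
    {X : l2Z →L[ℂ] l2Z} (hX : IsBanded b X) (hXr : ‖X‖ ≤ r) {a : ℝ} (ha : |a| ≤ 1) (l k : ℤ) :
    ‖⟪e l, binomialSum a X (e k)⟫‖ ≤ (1 - r)⁻¹ * r ^ ((|l - k| : ℝ) / (b : ℝ)) := by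
  have hr0 : 0 ≤ r := (norm_nonneg X).trans hXr
  have hb' : (0 : ℝ) < b := by exact_mod_cast hb
  have hsum := hasSum_inner_binomialSum ha (hXr.trans_lt hr) (e l) (e k)
  set f : ℕ → ℂ := fun n => Ring.choose a n • ⟪e l, (X ^ n) (e k)⟫ with hf
  have hbound : ∀ n, ‖f n‖ ≤ r ^ n := by
    intro n
    have hin : ‖⟪e l, (X ^ n) (e k)⟫‖ ≤ ‖X‖ ^ n := by
      refine (norm_inner_le_norm _ _).trans ?_
      have h := (X ^ n).le_opNorm (e k)
      rw [norm_e, mul_one] at h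
      rw [norm_e, one_mul]
      exact h.trans (norm_pow_le X n)
    rw [hf, norm_smul, Real.norm_eq_abs]
    exact (mul_le_of_le_one_left (norm_nonneg _) (Ring.abs_choose_le_one ha n)).trans
      (hin.trans (pow_le_pow_left₀ (norm_nonneg X) hXr n))
  set m := ⌈(|l - k| : ℝ) / b⌉₊
  have hzero : ∀ n ∈ Finset.range m, f n = 0 := by
    intro n hn
    have h1 : (n : ℝ) * b < |(l : ℝ) - k| := by
      rw [← lt_div_iff₀ hb']
      exact Nat.lt_ceil.mp (Finset.mem_range.mp hn)
    have h2 : (n : ℤ) * b < |l - k| := by exact_mod_cast h1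
    simp only [hf, hX.pow n l k h2, smul_zero]
  have htail : HasSum (fun n => f (n + m)) ⟪e l, binomialSum a X (e k)⟫ := by
    rw [hasSum_nat_add_iff, Finset.sum_eq_zero hzero, add_zero]
    exact hsum
  have hgeom : HasSum (fun n => r ^ (n + m)) ((1 - r)⁻¹ * r ^ m) := by
    simpa only [pow_add] using (hasSum_geometric_of_lt_one hr0 hr).mul_right (r ^ m)
  calc ‖⟪e l, binomialSum a X (e k)⟫‖ ≤ (1 - r)⁻¹ * r ^ m := by
        rw [← htail.tsum_eq]
        exact tsum_of_norm_bounded hgeom fun n => hbound _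
    _ ≤ _ := by
        refine mul_le_mul_of_nonneg_left ?_ (inv_nonneg.mpr (sub_nonneg.mpr hr.le))
        rw [← Real.rpow_natCast]
        exact Real.rpow_le_rpow_of_exponent_ge' hr0 hr.le (by positivity) (Nat.le_ceil _)

/-- Lemma 3.3 of the paper: if `A` is self-adjoint, banded with bandwidth `b`, and
`‖A − I‖ ≤ r < 1`, then the entries of its positive square root `Q` decay exponentially off
the diagonal, `|q_{lk}| ≤ K r^{|l−k|/b}`; moreover `A` and `Q` are invertible and the entries
of `Q⁻¹` satisfy a bound of the same form. -/
theorem stmt_4 (b : ℕ) (hb : 0 < b) (r : ℝ) (hr : r < 1)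
    (A : l2Z →L[ℂ] l2Z) (hAsa : IsSelfAdjoint A)
    (hband : ∀ i k : ℤ, |i - k| > (b : ℤ) → ⟪e i, A (e k)⟫ = 0)
    (hnorm : ‖A - 1‖ ≤ r)
    (Q : l2Z →L[ℂ] l2Z) (hQpos : Q.IsPositive) (hQ : Q ∘L Q = A) :
    (∃ K : ℝ, ∀ l k : ℤ, ‖⟪e l, Q (e k)⟫‖ ≤ K * r ^ ((|l - k| : ℝ) / (b : ℝ))) ∧
    IsUnit A ∧ IsUnit Q ∧
    (∃ K' : ℝ, ∀ l k : ℤ,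
      ‖⟪e l, Ring.inverse Q (e k)⟫‖ ≤ K' * r ^ ((|l - k| : ℝ) / (b : ℝ))) := by
  have hX1 : ‖A - 1‖ < 1 := hnorm.trans_lt hr
  have hX : IsBanded b (A - 1) :=
    IsBanded.sub (fun i k hik => hband i k hik) (isBanded_one.mono (Int.natCast_nonneg b))
  have h2 : |(1 / 2 : ℝ)| ≤ 1 := by norm_num [abs_le]
  have h2' : |(-(1 / 2) : ℝ)| ≤ 1 := by rwa [abs_neg]
  have hQeq : Q = binomialSum (1 / 2) (A - 1) :=
    eq_binomialSum_half_of_mul_self_eq hAsa hX1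
      ((ContinuousLinearMap.nonneg_iff_isPositive Q).mpr hQpos) hQ
  let u : (l2Z →L[ℂ] l2Z)ˣ := ⟨binomialSum (1 / 2) (A - 1), binomialSum (-(1 / 2)) (A - 1),
    binomialSum_mul_neg h2 hX1, binomialSum_neg_mul h2 hX1⟩
  have hQu : IsUnit Q := hQeq ▸ u.isUnit
  have hinv : Ring.inverse Q = binomialSum (-(1 / 2)) (A - 1) := hQeq ▸ Ring.inverse_unit u
  refine ⟨⟨(1 - r)⁻¹, fun l k => ?_⟩, hQ ▸ hQu.mul hQu, hQu, ⟨(1 - r)⁻¹, fun l k => ?_⟩⟩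
  · rw [hQeq]
    exact hX.norm_binomialSum_entry_le hb hr hnorm h2 l k
  · rw [hinv]
    exact hX.norm_binomialSum_entry_le hb hr hnorm h2' l k
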